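/- arXiv:1507.04258 — 2 statements merged into one kernel-verified Lean document; each statement's English description precedes it below -/
import Mathlib

section
/- Let d ≥ 2 be an integer and let G be a finite simple graph without isolated vertices. Then Θ_{d-1}(G) ≤ d if and only if G arises from the star K_{1,d} by replacing each of its d+1 vertices by a possibly empty clique (where two replacement vertices are adjacent iff they lie in the same clique or their original vertices are adjacent in K_{1,d}). -/
/-- The `p`-intersection number `Θ_p(G)`. -/
noncomputable def SimpleGraph.pIntersectionNumber {V : Type*} (G : SimpleGraph V)
    (p : ℕ) : ℕ :=
  sInf {d : ℕ | ∃ S : V → Finset (Fin d),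
    ∀ u v : V, u ≠ v → (G.Adj u v ↔ p ≤ (S u ∩ S v).card)}

/-- The star `K_{1,d}`: the center `none` is adjacent to the `d` leaves `some i`. -/
def starGraph (d : ℕ) : SimpleGraph (Option (Fin d)) :=
  SimpleGraph.fromRel (fun u v => u = none ∧ v ≠ none)

/-- `G` arises from `G₀` by replacing every vertex by a possibly empty clique:
two replacement vertices are adjacent iff they replace the same vertex or their
original vertices are adjacent in `G₀`. -/
def SimpleGraph.IsCliqueBlowup {V W : Type*} (G0 : SimpleGraph V)
    (G : SimpleGraph W) : Prop :=
  ∃ φ : W → V, ∀ w w' : W, w ≠ w' →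
    (G.Adj w w' ↔ (φ w = φ w' ∨ G0.Adj (φ w) (φ w')))

namespace SimpleGraph

variable {V : Type*} {G : SimpleGraph V}

/-- `S` is a `p`-intersection representation of `G`. -/
def IsPIntersectionRep {U : Type*} [DecidableEq U] (G : SimpleGraph V) (p : ℕ)
    (S : V → Finset U) : Prop :=
  ∀ u v : V, u ≠ v → (G.Adj u v ↔ p ≤ (S u ∩ S v).card)

/-- A representation may be transported along an embedding of ground sets. -/
theorem IsPIntersectionRep.map {U U' : Type*} [DecidableEq U] [DecidableEq U'] {p : ℕ}
    {S : V → Finset U} (hS : G.IsPIntersectionRep p S) (f : U ↪ U') :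
    G.IsPIntersectionRep p fun v => (S v).map f := by
  intro u v huv
  rw [hS u v huv, ← Finset.map_inter, Finset.card_map]

/-- For `p ≥ 1`, the sets of `p`-fold incident edges represent a finite graph. -/
theorem exists_isPIntersectionRep [Fintype V] (G : SimpleGraph V) {p : ℕ} (hp : 1 ≤ p) :
    ∃ (n : ℕ) (S : V → Finset (Fin n)), G.IsPIntersectionRep p S := by
  classical
  let S : V → Finset (Fin p × Sym2 V) := fun v => Finset.univ ×ˢ G.incidenceFinset v
  have hS : G.IsPIntersectionRep p S := by
    intro u v huv
    have hinter : S u ∩ S v =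
        Finset.univ ×ˢ (G.incidenceFinset u ∩ G.incidenceFinset v) := by
      ext x
      simp [S]
    rw [hinter, Finset.card_product, Finset.card_univ, Fintype.card_fin]
    constructor
    · intro h
      refine Nat.le_mul_of_pos_right p (Finset.card_pos.2 ⟨s(u, v), ?_⟩)
      simp [mem_incidenceFinset, mk'_mem_incidenceSet_iff, h]
    · intro h
      have hpos : 0 < (G.incidenceFinset u ∩ G.incidenceFinset v).card :=
        Nat.pos_of_mul_pos_left (hp.trans h)
      obtain ⟨e, he⟩ := Finset.card_pos.1 hpos
      rw [Finset.mem_inter, mem_incidenceFinset, mem_incidenceFinset] at he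
      exact G.adj_of_mem_incidenceSet huv he.1 he.2
  exact ⟨_, _, hS.map (Fintype.equivFin _).toEmbedding⟩

/-- For `p ≥ 1`, `Θ_p(G) ≤ d` iff `G` has a representation on exactly `d` points. -/
theorem pIntersectionNumber_le_iff [Fintype V] {p d : ℕ} (hp : 1 ≤ p) :
    G.pIntersectionNumber p ≤ d ↔ ∃ S : V → Finset (Fin d), G.IsPIntersectionRep p S := by
  constructor
  · intro h
    obtain ⟨S, hS⟩ : ∃ S : V → Finset (Fin (G.pIntersectionNumber p)),
        G.IsPIntersectionRep p S := Nat.sInf_mem (G.exists_isPIntersectionRep hp)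
    exact ⟨_, IsPIntersectionRep.map hS (Fin.castLEEmb h)⟩
  · exact fun h => Nat.sInf_le h

end SimpleGraph

/-- The subset of `Fin d` attached to a vertex of `K_{1,d}`: everything for the center, and
everything but `i` for the leaf `i`. -/
def starSet (d : ℕ) : Option (Fin d) → Finset (Fin d)
  | none => Finset.univ
  | some i => {i}ᶜ

theorem sub_one_le_card_starSet_inter_iff {d : ℕ} (hd : 2 ≤ d) (a b : Option (Fin d)) :
    d - 1 ≤ (starSet d a ∩ starSet d b).card ↔ a = b ∨ (starGraph d).Adj a b := by
  rcases a with _ | i <;> rcases b with _ | j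
  · simp [starSet]
  · simp [starSet, starGraph, Finset.card_compl]
  · simp [starSet, starGraph, Finset.card_compl]
  · rcases eq_or_ne i j with rfl | hij
    · simp [starSet, Finset.card_compl]
    · have hcard : (starSet d (some i) ∩ starSet d (some j)).card = d - 2 := by
        rw [starSet, starSet, ← Finset.compl_union, Finset.card_compl, Fintype.card_fin,
          ← Finset.insert_eq, Finset.card_pair hij]
      rw [hcard]
      simp only [starGraph, SimpleGraph.fromRel_adj, Option.some.injEq, hij, reduceCtorEq,
        false_and, or_self, and_false, iff_false]
      omega

/-- The sets with at least `d - 1` elements are exactly those attached to vertices of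
`K_{1,d}`. -/
theorem exists_eq_starSet {d : ℕ} {s : Finset (Fin d)} (hs : d - 1 ≤ s.card) :
    ∃ a, s = starSet d a := by
  have hcompl : sᶜ.card ≤ 1 := by
    rw [Finset.card_compl, Fintype.card_fin]
    omega
  rcases sᶜ.eq_empty_or_nonempty with h | ⟨i, hi⟩
  · exact ⟨none, Finset.compl_eq_empty_iff s |>.1 h⟩
  · refine ⟨some i, ?_⟩
    rw [starSet, ← compl_compl s, Finset.eq_singleton_iff_unique_mem.2
      ⟨hi, fun j hj => Finset.card_le_one.1 hcompl j hj i hi⟩]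

/-- Theorem 3, (i) ⇔ (ii): for an integer `d ≥ 2` and a finite graph `G` without
isolated vertices, `Θ_{d-1}(G) ≤ d` if and only if `G` arises from the star
`K_{1,d}` by replacing each of its vertices by a possibly empty clique. -/
theorem pIntersectionNumber_le_iff_star_blowup {V : Type*} [Fintype V]
    (d : ℕ) (hd : 2 ≤ d) (G : SimpleGraph V)
    (hiso : ∀ v : V, ∃ w : V, G.Adj v w) :
    G.pIntersectionNumber (d - 1) ≤ d ↔
      SimpleGraph.IsCliqueBlowup (starGraph d) G := by
  rw [SimpleGraph.pIntersectionNumber_le_iff (by omega)]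
  constructor
  · rintro ⟨S, hS⟩
    have hstar : ∀ v, ∃ a, S v = starSet d a := fun v => by
      obtain ⟨w, hw⟩ := hiso v
      exact exists_eq_starSet
        (((hS v w hw.ne).1 hw).trans (Finset.card_le_card Finset.inter_subset_left))
    choose φ hφ using hstar
    refine ⟨φ, fun u v huv => ?_⟩
    rw [hS u v huv, hφ u, hφ v, sub_one_le_card_starSet_inter_iff hd]
  · rintro ⟨φ, hφ⟩
    refine ⟨fun v => starSet d (φ v), fun u v huv => ?_⟩
    rw [hφ u v huv, sub_one_le_card_starSet_inter_iff hd]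
end

section
/- Let d ≥ 2 be an integer and let G be a finite simple graph without isolated vertices that contains none of K̄_{d+1}, P₄, K₁ ∪ P₃, and C₄ as an induced subgraph. Then G arises from the star K_{1,d} by replacing each of its d+1 vertices by a possibly empty clique (where two replacement vertices are adjacent iff they lie in the same clique or their original vertices are adjacent in K_{1,d}). -/
/-- `G` contains `F` as an induced subgraph. -/
def SimpleGraph.HasInducedCopy {α β : Type*} (F : SimpleGraph α)
    (G : SimpleGraph β) : Prop :=
  Nonempty (F ↪g G)

/-- The disjoint union `K₁ ∪ P₃` of a single vertex and a path on three vertices. -/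
def K1uP3 : SimpleGraph (Fin 1 ⊕ Fin 3) :=
  (⊥ : SimpleGraph (Fin 1)) ⊕g SimpleGraph.pathGraph 3

namespace SimpleGraph

variable {V : Type*} {G : SimpleGraph V}

theorem HasInducedCopy.of_injective {W : Type*} {F : SimpleGraph W} (f : W → V)
    (hf : Function.Injective f) (hadj : ∀ i j, G.Adj (f i) (f j) ↔ F.Adj i j) :
    HasInducedCopy F G :=
  ⟨⟨⟨f, hf⟩, hadj _ _⟩⟩

/-- A graph without induced `P₄`, `K₁ ∪ P₃` and `C₄` has only universal vertices as middle
vertices of induced paths on three vertices. -/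
theorem adj_middle_of_forb
    (hP : ¬ HasInducedCopy (pathGraph 4) G) (hK : ¬ HasInducedCopy K1uP3 G)
    (hC : ¬ HasInducedCopy (cycleGraph 4) G) {a b c : V} (hab : G.Adj a b) (hbc : G.Adj b c)
    (hac : ¬ G.Adj a c) (hne : a ≠ c) (x : V) (hx : x ≠ b) : G.Adj b x := by
  by_contra hbx
  have hxa : x ≠ a := by rintro rfl; exact hbx hab.symm
  have hxc : x ≠ c := by rintro rfl; exact hbx hbc
  have hxb : ¬ G.Adj x b := fun h => hbx h.symm
  have hca : ¬ G.Adj c a := fun h => hac h.symm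
  by_cases h1 : G.Adj x a <;> by_cases h2 : G.Adj x c
  · refine hC (HasInducedCopy.of_injective ![x, a, b, c] ?_ ?_)
    · intro i j
      fin_cases i <;> fin_cases j <;>
        simp [hx, hxa, hxc, hne, hx.symm, hxa.symm, hxc.symm, hne.symm, hab.ne, hab.ne.symm,
          hbc.ne, hbc.ne.symm]
    · intro i j
      fin_cases i <;> fin_cases j <;>
        simp [cycleGraph_adj, h1, h2, h1.symm, h2.symm, hab, hbc, hab.symm, hbc.symm, hac, hca,
          hxb, hbx] <;> decide
  · have h2' : ¬ G.Adj c x := fun h => h2 h.symm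
    refine hP (HasInducedCopy.of_injective ![x, a, b, c] ?_ ?_)
    · intro i j
      fin_cases i <;> fin_cases j <;>
        simp [hx, hxa, hxc, hne, hx.symm, hxa.symm, hxc.symm, hne.symm, hab.ne, hab.ne.symm,
          hbc.ne, hbc.ne.symm]
    · intro i j
      fin_cases i <;> fin_cases j <;>
        simp [pathGraph_adj, h1, h2, h1.symm, h2', hab, hbc, hab.symm, hbc.symm, hac, hca,
          hxb, hbx]
  · have h1' : ¬ G.Adj a x := fun h => h1 h.symm
    refine hP (HasInducedCopy.of_injective ![x, c, b, a] ?_ ?_)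
    · intro i j
      fin_cases i <;> fin_cases j <;>
        simp [hx, hxa, hxc, hne, hx.symm, hxa.symm, hxc.symm, hne.symm, hab.ne, hab.ne.symm,
          hbc.ne, hbc.ne.symm]
    · intro i j
      fin_cases i <;> fin_cases j <;>
        simp [pathGraph_adj, h1, h2, h2.symm, h1', hab, hbc, hab.symm, hbc.symm, hac, hca,
          hxb, hbx]
  · have h1' : ¬ G.Adj a x := fun h => h1 h.symm
    have h2' : ¬ G.Adj c x := fun h => h2 h.symm
    refine hK (HasInducedCopy.of_injective (Sum.elim ![x] ![a, b, c]) ?_ ?_)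
    · rintro (i | i) (j | j) <;> fin_cases i <;> fin_cases j <;>
        simp [hx, hxa, hxc, hne, hx.symm, hxa.symm, hxc.symm, hne.symm, hab.ne, hab.ne.symm,
          hbc.ne, hbc.ne.symm]
    · rintro (i | i) (j | j) <;> fin_cases i <;> fin_cases j <;>
        simp [K1uP3, pathGraph_adj, h1, h2, h2', h1', hab, hbc, hab.symm, hbc.symm, hac, hca,
          hxb, hbx]

/-- Equality or adjacency, an equivalence relation on the non-universal vertices when the middle
vertex of every induced path on three vertices is universal. -/
def cliqueSetoid
    (hG : ∀ a b c, G.Adj a b → G.Adj b c → ¬ G.Adj a c → a ≠ c → ∀ x, x ≠ b → G.Adj b x) :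
    Setoid {v : V // ¬ ∀ x, x ≠ v → G.Adj v x} where
  r v w := v = w ∨ G.Adj v w
  iseqv :=
    { refl := fun _ => Or.inl rfl
      symm := fun h => h.imp Eq.symm fun h => h.symm
      trans := by
        rintro a b c (rfl | hab) (rfl | hbc)
        · exact Or.inl rfl
        · exact Or.inr hbc
        · exact Or.inr hab
        · by_contra! h
          exact b.2 (hG _ _ _ hab hbc h.2 fun hac => h.1 (Subtype.ext hac)) }

theorem starGraph_adj_none_some {d : ℕ} (i : Fin d) : (_root_.starGraph d).Adj none (some i) := by
  simp [_root_.starGraph]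

theorem not_starGraph_adj_some_some {d : ℕ} (i j : Fin d) :
    ¬ (_root_.starGraph d).Adj (some i) (some j) := by
  simp [_root_.starGraph]

/-- Representatives of distinct classes form an independent set, so there are at most `d`
classes if `G` has no independent set of size `d + 1`. -/
theorem card_quotient_cliqueSetoid_le [Finite V] {d : ℕ}
    (hI : ¬ HasInducedCopy (⊥ : SimpleGraph (Fin (d + 1))) G)
    (hG : ∀ a b c, G.Adj a b → G.Adj b c → ¬ G.Adj a c → a ≠ c → ∀ x, x ≠ b → G.Adj b x) :
    Nat.card (Quotient (cliqueSetoid hG)) ≤ d := by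
  by_contra! hcard
  have e := Finite.equivFin (Quotient (cliqueSetoid hG))
  let f : Fin (d + 1) ↪ Quotient (cliqueSetoid hG) :=
    (Fin.castLEEmb hcard).trans e.symm.toEmbedding
  refine hI (.of_injective (fun i => ((f i).out : V)) (fun i j hij => ?_) fun i j => ?_)
  · exact f.injective (Quotient.out_injective (Subtype.ext hij))
  · simp only [bot_adj, iff_false]
    intro hadj
    have hij : f i = f j := by
      rw [← (f i).out_eq, ← (f j).out_eq]
      exact Quotient.sound (Or.inr hadj)
    rw [hij] at hadj
    exact hadj.ne rfl

/-- If the middle vertex of every induced path on three vertices is universal and there is no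
independent set of size `d + 1`, then `G` is a clique blowup of `K_{1,d}`. -/
theorem isCliqueBlowup_starGraph [Finite V] {d : ℕ}
    (hI : ¬ HasInducedCopy (⊥ : SimpleGraph (Fin (d + 1))) G)
    (hG : ∀ a b c, G.Adj a b → G.Adj b c → ¬ G.Adj a c → a ≠ c → ∀ x, x ≠ b → G.Adj b x) :
    IsCliqueBlowup (_root_.starGraph d) G := by
  classical
  let f : Quotient (cliqueSetoid hG) ↪ Fin d :=
    (Finite.equivFin _).toEmbedding.trans (Fin.castLEEmb (card_quotient_cliqueSetoid_le hI hG))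
  refine ⟨fun v => if h : ∀ x, x ≠ v → G.Adj v x then none
    else some (f (Quotient.mk _ ⟨v, h⟩)), fun v w hvw => ?_⟩
  beta_reduce
  by_cases hv : ∀ x, x ≠ v → G.Adj v x <;> by_cases hw : ∀ x, x ≠ w → G.Adj w x
  · rw [dif_pos hv, dif_pos hw]
    exact iff_of_true (hv w hvw.symm) (Or.inl rfl)
  · rw [dif_pos hv, dif_neg hw]
    exact iff_of_true (hv w hvw.symm) (Or.inr (starGraph_adj_none_some _))
  · rw [dif_neg hv, dif_pos hw]
    exact iff_of_true (hw v hvw).symm (Or.inr (starGraph_adj_none_some _).symm)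
  · rw [dif_neg hv, dif_neg hw]
    simp only [not_starGraph_adj_some_some, or_false, Option.some.injEq,
      EmbeddingLike.apply_eq_iff_eq]
    refine ⟨fun h => Quotient.sound (Or.inr h), fun h => ?_⟩
    exact (Quotient.exact h).resolve_left fun h => hvw (congrArg Subtype.val h)

end SimpleGraph

/-- Theorem 3, (iii) ⇒ (ii): for an integer `d ≥ 2`, a finite graph `G` without
isolated vertices containing none of `K̄_{d+1}`, `P₄`, `K₁ ∪ P₃` and `C₄` as an
induced subgraph arises from the star `K_{1,d}` by replacing each of its vertices
by a possibly empty clique. -/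
theorem forb_implies_star_blowup {V : Type*} [Fintype V]
    (d : ℕ) (hd : 2 ≤ d) (G : SimpleGraph V)
    (hiso : ∀ v : V, ∃ w : V, G.Adj v w)
    (h1 : ¬ SimpleGraph.HasInducedCopy (⊥ : SimpleGraph (Fin (d + 1))) G)
    (h2 : ¬ SimpleGraph.HasInducedCopy (SimpleGraph.pathGraph 4) G)
    (h3 : ¬ SimpleGraph.HasInducedCopy K1uP3 G)
    (h4 : ¬ SimpleGraph.HasInducedCopy (SimpleGraph.cycleGraph 4) G) :
    SimpleGraph.IsCliqueBlowup (starGraph d) G := by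
  exact SimpleGraph.isCliqueBlowup_starGraph h1
    fun _ _ _ => SimpleGraph.adj_middle_of_forb h2 h3 h4
end
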